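/- arXiv:1710.10990 — 2 statements merged into one kernel-verified Lean document; each statement's English description precedes it below -/
import Mathlib

section
/- Let n ≥ 3 be an integer and let 0 < m < m_max. Then 1 < k_+(m) < sqrt(n), i.e. the surface gravity of the cosmological horizon of the Schwarzschild–de Sitter solution of mass m is strictly between 1 and sqrt(n). -/
open Set Filter Topology

noncomputable def mMax (n : ℕ) : ℝ := Real.sqrt (((n : ℝ) - 2) ^ (n - 2) / (n : ℝ) ^ n)

noncomputable def fSD (n : ℕ) (m r : ℝ) : ℝ := 1 - r ^ 2 - 2 * m * r ^ (2 - (n : ℝ))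

lemma auxA (p x : ℝ) (hp : 0 < p) (hpx : p < x) (hx : x < 1) :
    1 - Real.exp (p * (Real.log x - Real.log p) + (1-p) * (Real.log (1-x) - Real.log (1-p)))
      < (x-p)^2 / ((1-p)^2 * x) := by
  have hx0 : 0 < x := hp.trans hpx
  have hq : 0 < 1 - p := by linarith
  have hy : 0 < 1 - x := by linarith
  set L := p * (Real.log x - Real.log p) + (1-p) * (Real.log (1-x) - Real.log (1-p)) with hL
  have h1 := Real.geom_mean_le_arith_mean2_weighted hp.le hq.le (div_pos hp hx0).le
    (div_pos hq hy).le (by ring)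
  have h2 : (p/x)^p * ((1-p)/(1-x))^(1-p) = Real.exp (-L) := by
    rw [Real.rpow_def_of_pos (div_pos hp hx0), Real.rpow_def_of_pos (div_pos hq hy),
      ← Real.exp_add, Real.log_div hp.ne' hx0.ne', Real.log_div hq.ne' hy.ne']
    congr 1
    rw [hL]; ring
  rw [h2, Real.exp_neg] at h1
  have hd : 0 < (x-p)^2 := by have : 0 < x - p := by linarith
                              positivity
  have h3 : p * (p/x) + (1-p) * ((1-p)/(1-x)) = (x*(1-x) + (x-p)^2)/(x*(1-x)) := by
    field_simp
    ring
  rw [h3] at h1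
  have hD : 0 < x*(1-x) + (x-p)^2 := by positivity
  have h4 : x*(1-x) / (x*(1-x) + (x-p)^2) ≤ Real.exp L := by
    have := inv_anti₀ (by positivity) h1
    rwa [inv_inv, inv_div] at this
  have h5 : 1 - x*(1-x) / (x*(1-x) + (x-p)^2) = (x-p)^2 / (x*(1-x) + (x-p)^2) := by
    field_simp
    ring
  have h6 : (x-p)^2 / (x*(1-x) + (x-p)^2) < (x-p)^2 / ((1-p)^2 * x) := by
    apply div_lt_div_of_pos_left hd (by positivity)
    nlinarith [mul_pos (mul_pos hp hp) hy]
  linarith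

lemma auxB (p x : ℝ) (hp : 0 < p) (hpx : p < x) (hx : x < 1) :
    (x-p)^2 / (2 * (1-p) * x) < 1 -
     Real.exp (p * (Real.log x - Real.log p) + (1-p) * (Real.log (1-x) - Real.log (1-p))) := by
  have hx0 : 0 < x := hp.trans hpx
  have hq : 0 < 1 - p := by linarith
  have key : ∀ t, p ≤ t → t < 1 → 0 < 2*(1-p)*t - (t-p)^2 := by
    intro t h1 h2
    nlinarith [mul_pos (show 0 < t + p by linarith) (sub_pos.2 h2),
      mul_nonneg (sub_nonneg.2 h1) (show 0 ≤ 1 + p by linarith)]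
  let F : ℝ → ℝ := fun t => Real.log (2*(1-p)*t - (t-p)^2) - Real.log t - p * Real.log t
    - (1-p) * Real.log (1-t)
  have hF : ∀ t, p ≤ t → t < 1 → HasDerivAt F
      ((2*(1-p) - 2*(t-p)) / (2*(1-p)*t - (t-p)^2) - 1/t - p * (1/t) - (1-p) * (-1/(1-t))) t := by
    intro t h1 h2
    have ht : t ≠ 0 := by linarith
    have ha : HasDerivAt (fun t : ℝ => 2*(1-p)*t - (t-p)^2) (2*(1-p) - 2*(t-p)) t := by
      have := ((hasDerivAt_id t).const_mul (2*(1-p))).sub (((hasDerivAt_id t).sub_const p).pow 2)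
      exact this.congr_deriv (by simp)
    have hl : HasDerivAt (fun t : ℝ => Real.log t) (1/t) t := by
      simpa using Real.hasDerivAt_log ht
    have hb : HasDerivAt (fun t : ℝ => Real.log (1-t)) (-1/(1-t)) t :=
      ((hasDerivAt_id t).const_sub 1).log (by simp; linarith)
    exact (((ha.log (key t h1 h2).ne').sub hl).sub (hl.const_mul p)).sub (hb.const_mul (1-p))
  have hmono : StrictMonoOn F (Ico p 1) := by
    apply strictMonoOn_of_deriv_pos (convex_Ico p 1)
    · intro t ht
      exact (hF t ht.1 ht.2).continuousAt.continuousWithinAt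
    · intro t ht
      rw [interior_Ico] at ht
      rw [(hF t ht.1.le ht.2).deriv]
      have hK := key t ht.1.le ht.2
      have ht0 : 0 < t := hp.trans ht.1
      have h1t : 0 < 1 - t := by linarith [ht.2]
      have htp : 0 < t - p := by linarith [ht.1]
      have : (2*(1-p) - 2*(t-p)) / (2*(1-p)*t - (t-p)^2) - 1/t - p * (1/t) - (1-p) * (-1/(1-t))
        = (t-p)^2*(1+p) / ((2*(1-p)*t - (t-p)^2) * t * (1-t)) := by
        have := hK.ne'
        field_simp
        ring
      rw [this]
      positivity
  have hlt := hmono (left_mem_Ico.2 (by linarith)) ⟨hpx.le, hx⟩ hpx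
  have hK := key x hpx.le hx
  have hFp : F p = Real.log (2*(1-p)) - p * Real.log p - (1-p) * Real.log (1-p) := by
    simp only [F]
    rw [sub_self, zero_pow two_ne_zero, sub_zero, Real.log_mul (by positivity) hp.ne']
    ring
  have hH : 1 - (x-p)^2 / (2 * (1-p) * x) = (2*(1-p)*x - (x-p)^2) / (2*(1-p)*x) := by
    field_simp
  rw [lt_sub_comm, hH, ← Real.lt_log_iff_exp_lt (by positivity),
    Real.log_div hK.ne' (by positivity), Real.log_mul (by positivity) hx0.ne']
  rw [hFp] at hlt
  simp only [F] at hlt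
  linarith

lemma mMax_eq (k : ℕ) : mMax (k+2) = Real.sqrt ((k:ℝ)/(k+2)) ^ k / (k+2) := by
  unfold mMax
  rw [Real.sqrt_eq_iff_mul_self_eq]
  · have h : (0:ℝ) ≤ (k:ℝ)/(k+2) := by positivity
    have h2 : Real.sqrt ((k:ℝ)/(k+2)) ^ k / (k+2) * (Real.sqrt ((k:ℝ)/(k+2)) ^ k / (k+2))
      = (Real.sqrt ((k:ℝ)/(k+2)) ^ 2)^k / (k+2)^2 := by
      rw [← pow_mul, mul_comm 2 k, pow_mul]
      field_simp
    rw [h2, Real.sq_sqrt h]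
    push_cast
    simp only [Nat.add_sub_cancel, add_sub_cancel_right]
    rw [div_pow, pow_add]
    field_simp
  · push_cast
    simp only [add_sub_cancel_right]
    positivity
  · positivity

lemma fSD_eq (k : ℕ) (m r : ℝ) (hr : 0 < r) :
    fSD (k+2) m r = 1 - r^2 - 2*m/r^k := by
  unfold fSD
  have : (2 - ((k+2:ℕ):ℝ)) = -(k:ℝ) := by push_cast; ring
  rw [this, Real.rpow_neg hr.le, Real.rpow_natCast]
  ring

/-- the outer surface gravity satisfies 1 < k_+(m) < sqrt n for
0 < m < m_max. -/
theorem stmt8 (n : ℕ) (hn : 3 ≤ n) (m : ℝ) (hm₀ : 0 < m) (hm₁ : m < mMax n)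
    (rp : ℝ) (hrp : IsGreatest {r : ℝ | 0 < r ∧ fSD n m r = 0} rp) :
    1 < Real.sqrt (rp ^ 2 * (1 - ((n : ℝ) - 2) * m * rp ^ (-(n : ℝ))) ^ 2 /
        (1 - (m / mMax n) ^ ((2 : ℝ) / n))) ∧
    Real.sqrt (rp ^ 2 * (1 - ((n : ℝ) - 2) * m * rp ^ (-(n : ℝ))) ^ 2 /
        (1 - (m / mMax n) ^ ((2 : ℝ) / n))) < Real.sqrt n := by
  obtain ⟨k, rfl⟩ : ∃ k, n = k + 2 := ⟨n - 2, by omega⟩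
  have hk : (1:ℝ) ≤ k := by exact_mod_cast (by omega : 1 ≤ k)
  have hk0 : (0:ℝ) < k := by linarith
  obtain ⟨⟨hr, hf⟩, hmax⟩ := hrp
  rw [fSD_eq k m rp hr] at hf
  set p : ℝ := (k:ℝ)/(k+2) with hpdef
  have hp : 0 < p := by positivity
  have hq : 1 - p = 2/(k+2) := by rw [hpdef]; field_simp; ring
  have hp1 : p < 1 := by
    have : 0 < 1 - p := by rw [hq]; positivity
    linarith
  have hM := mMax_eq k
  rw [← hpdef] at hM
  have hs : 0 < Real.sqrt p := Real.sqrt_pos.2 hp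
  have hs2 : Real.sqrt p ^ 2 = p := Real.sq_sqrt hp.le
  have hMpos : 0 < mMax (k+2) := hm₀.trans hm₁
  have hx1 : rp^2 < 1 := by
    have : 0 < 2*m/rp^k := by positivity
    linarith
  have hpx : p < rp^2 := by
    by_contra hcon
    push Not at hcon
    have hle : rp ≤ Real.sqrt p := Real.le_sqrt_of_sq_le hcon
    have hs1 : Real.sqrt p ≤ 1 := Real.sqrt_le_one.2 hp1.le
    have hc : ContinuousOn (fSD (k+2) m) (Icc (Real.sqrt p) 1) := by
      have : ContinuousOn (fun r : ℝ => 1 - r^2 - 2*m/r^k) (Icc (Real.sqrt p) 1) := by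
        apply ContinuousOn.sub (by fun_prop)
        apply ContinuousOn.div (by fun_prop) (by fun_prop)
        intro r h
        exact pow_ne_zero _ (by linarith [h.1])
      exact this.congr fun r h => fSD_eq k m r (by linarith [h.1])
    have h1 : fSD (k+2) m 1 < 0 := by rw [fSD_eq k m 1 one_pos]; simp; exact hm₀
    have h0 : 0 < fSD (k+2) m (Real.sqrt p) := by
      rw [fSD_eq k m _ hs, hs2, hq, sub_pos, div_lt_div_iff₀ (by positivity) (by positivity)]
      rw [hM, lt_div_iff₀ (by positivity)] at hm₁
      linarith
    obtain ⟨r, hrI, hr0⟩ := intermediate_value_Ioo' hs1 hc ⟨h1, h0⟩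
    have := hmax ⟨hs.trans hrI.1, hr0⟩
    linarith [hrI.1]
  have hm : m = rp^k * (1 - rp^2) / 2 := by
    have : 2*m/rp^k = 1 - rp^2 := by linarith
    rw [div_eq_iff (by positivity)] at this
    linarith
  have hy : 0 < 1 - rp^2 := by linarith
  have hG : (m / mMax (k+2)) ^ ((2:ℝ)/((k+2:ℕ):ℝ)) = Real.exp (p * (Real.log (rp^2) - Real.log p)
      + (1-p) * (Real.log (1-rp^2) - Real.log (1-p))) := by
    rw [Real.rpow_def_of_pos (by positivity)]
    congr 1
    have e : m / mMax (k+2) = (rp^k * (1-rp^2)) / (Real.sqrt p ^ k * (1-p)) := by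
      rw [hm, hM, hq]; field_simp
    have hq0 : 0 < 1 - p := by linarith
    rw [e, Real.log_div (by positivity) (by positivity), Real.log_mul (by positivity) hy.ne',
      Real.log_mul (by positivity) hq0.ne', Real.log_pow, Real.log_pow, Real.log_pow,
      Real.log_sqrt hp.le]
    generalize Real.log (1-p) = A
    generalize Real.log p = B
    rw [hq, hpdef]
    push_cast
    field_simp
    ring
  have hN : rp ^ 2 * (1 - (((k+2:ℕ) : ℝ) - 2) * m * rp ^ (-((k+2:ℕ) : ℝ))) ^ 2
      = (rp^2 - p)^2 / ((1-p)^2 * rp^2) := by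
    rw [Real.rpow_neg hr.le, Real.rpow_natCast, hm, hq, hpdef, pow_add]
    push_cast
    field_simp
    ring
  rw [hG, hN]
  have hA := auxA p (rp^2) hp hpx hx1
  have hB := auxB p (rp^2) hp hpx hx1
  set E := Real.exp (p * (Real.log (rp^2) - Real.log p)
      + (1-p) * (Real.log (1-rp^2) - Real.log (1-p)))
  have hE : 0 < 1 - E := lt_of_le_of_lt (by have : 0 < 1 - p := by linarith
                                            positivity) hB
  constructor
  · rw [Real.lt_sqrt (by norm_num), one_pow, lt_div_iff₀ hE]
    linarith
  · apply Real.sqrt_lt_sqrt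
    · positivity
    · rw [div_lt_iff₀ hE]
      have e : (rp^2 - p)^2 / ((1-p)^2 * rp^2)
          = ((k+2:ℕ):ℝ) * ((rp^2 - p)^2 / (2 * (1-p) * rp^2)) := by
        rw [hq]; push_cast; field_simp
      rw [e]
      exact mul_lt_mul_of_pos_left hB (by positivity)
end

section
/- Let n ≥ 3 be an integer. The inner surface gravity function k_- is a continuous, strictly decreasing bijection from (0, m_max] onto [sqrt(n), ∞); in particular k_-(m) → +∞ as m → 0⁺ and k_-(m) → sqrt(n) as m → m_max⁻, so that the inverse k_-^(-1) : [sqrt(n), ∞) → (0, m_max] used in the definition of the virtual mass of an inner region is well defined. -/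
open Set Filter Topology

noncomputable def lF (a t : ℝ) : ℝ := a * Real.log t + (1 - a) * (Real.log (1 - a * t) - Real.log (1 - a))
noncomputable def HF (a t : ℝ) : ℝ := (1 - t) ^ 2 / (t * (1 - Real.exp (lF a t)))

lemma lF_one (a : ℝ) : lF a 1 = 0 := by simp [lF]

lemma at_lt {a t : ℝ} (ha : 0 < a) (ha1 : a < 1) (ht1 : t ≤ 1) : 0 < 1 - a * t := by nlinarith

lemma lF_deriv {a t : ℝ} (ha : 0 < a) (ha1 : a < 1) (ht : 0 < t) (ht1 : t ≤ 1) :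
    HasDerivAt (lF a) (a * (1 - t) / (t * (1 - a * t))) t := by
  have h := at_lt ha ha1 ht1
  have h1 := (Real.hasDerivAt_log ht.ne').const_mul a
  have h2 : HasDerivAt (fun t => 1 - a * t) (-a) t := by
    simpa using ((hasDerivAt_id t).const_mul a).const_sub 1
  have h3 := ((h2.log h.ne').sub_const (Real.log (1 - a))).const_mul (1 - a)
  have e : a * (1 - t) / (t * (1 - a * t)) = a * t⁻¹ + (1 - a) * (-a / (1 - a * t)) := by
    have := h.ne'
    field_simp
    ring
  rw [e]
  exact h1.add h3

lemma lF_cont {a : ℝ} (ha : 0 < a) (ha1 : a < 1) : ContinuousOn (lF a) (Ioc 0 1) :=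
  fun _ ht => (lF_deriv ha ha1 ht.1 ht.2).continuousAt.continuousWithinAt

lemma lF_mono {a : ℝ} (ha : 0 < a) (ha1 : a < 1) : StrictMonoOn (lF a) (Ioc 0 1) := by
  apply strictMonoOn_of_deriv_pos (convex_Ioc 0 1) (lF_cont ha ha1)
  intro t ht
  rw [interior_Ioc] at ht
  rw [(lF_deriv ha ha1 ht.1 ht.2.le).deriv]
  have h := at_lt ha ha1 ht.2.le
  have := ht.1
  have : 0 < 1 - t := by linarith [ht.2]
  positivity

lemma lF_neg {a t : ℝ} (ha : 0 < a) (ha1 : a < 1) (ht : t ∈ Ioo (0:ℝ) 1) : lF a t < 0 := by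
  rw [← lF_one a]
  exact lF_mono ha ha1 ⟨ht.1, ht.2.le⟩ ⟨one_pos, le_rfl⟩ ht.2

lemma lF_surj {a y : ℝ} (ha : 0 < a) (ha1 : a < 1) (hy : y < 0) : ∃ t ∈ Ioo (0:ℝ) 1, lF a t = y := by
  have h1 : Tendsto (lF a) (𝓝[>] 0) atBot := by
    have h2 : Tendsto (fun t : ℝ => (1 - a) * (Real.log (1 - a * t) - Real.log (1 - a))) (𝓝[>] 0)
        (𝓝 ((1 - a) * (Real.log (1 - a * 0) - Real.log (1 - a)))) := by
      apply Tendsto.mono_left _ nhdsWithin_le_nhds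
      have : ContinuousAt (fun t : ℝ => (1 - a) * (Real.log (1 - a * t) - Real.log (1 - a))) 0 := by
        have : 1 - a * 0 ≠ 0 := by norm_num
        fun_prop (disch := assumption)
      exact this
    exact (Real.tendsto_log_nhdsGT_zero.const_mul_atBot ha).atBot_add h2
  obtain ⟨s, hs, hs0⟩ := ((h1.eventually (eventually_lt_atBot y)).and
    (Ioo_mem_nhdsGT (one_pos : (0:ℝ) < 1))).exists
  have hsub : Icc s 1 ⊆ Ioc 0 1 := fun x hx => ⟨hs0.1.trans_le hx.1, hx.2⟩
  obtain ⟨t, ht, e⟩ := intermediate_value_Ioo hs0.2.le ((lF_cont ha ha1).mono hsub)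
    (show y ∈ Ioo (lF a s) (lF a 1) from ⟨hs, by rw [lF_one]; exact hy⟩)
  exact ⟨t, ⟨hs0.1.trans ht.1, ht.2⟩, e⟩

lemma D_pos {a t : ℝ} (ha : 0 < a) (ha1 : a < 1) (ht : 0 < t) (ht1 : t ≤ 1) :
    0 < 1 + t + a - 3 * a * t := by
  have h := at_lt ha ha1 ht1
  have h2 : 0 < (1 + t) * (1 - a * t) := by positivity
  have h3 : 0 ≤ a * (1 - t) ^ 2 := by positivity
  nlinarith

lemma key {a t : ℝ} (ha : 0 < a) (ha1 : a < 1) (ht : t ∈ Ioo (0:ℝ) 1) :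
    Real.exp (lF a t) * (1 + t + a - 3 * a * t) < (1 + t) * (1 - a * t) := by
  let L : ℝ → ℝ := fun t => Real.log (1 + t) + Real.log (1 - a * t) - Real.log (1 + t + a - 3 * a * t) - lF a t
  have hd : ∀ t, 0 < t → t ≤ 1 → HasDerivAt L
      (1 / (1 + t) + (-a) / (1 - a * t) - (1 - 3 * a) / (1 + t + a - 3 * a * t)
        - a * (1 - t) / (t * (1 - a * t))) t := by
    intro t ht ht1
    have h := at_lt ha ha1 ht1
    have h1 : HasDerivAt (fun t : ℝ => 1 + t) 1 t := by simpa using (hasDerivAt_id t).const_add 1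
    have h2 : HasDerivAt (fun t => 1 - a * t) (-a) t := by
      simpa using ((hasDerivAt_id t).const_mul a).const_sub 1
    have h3 : HasDerivAt (fun t => 1 + t + a - 3 * a * t) (1 - 3 * a) t := by
      have h4 : HasDerivAt (fun t => 3 * a * t) (3 * a) t := by
        simpa using (hasDerivAt_id t).const_mul (3 * a)
      exact (h1.add_const a).sub h4
    exact (((h1.log (by positivity)).add (h2.log h.ne')).sub
      (h3.log (D_pos ha ha1 ht ht1).ne')).sub (lF_deriv ha ha1 ht ht1)
  have hanti : StrictAntiOn L (Ioc 0 1) := by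
    apply strictAntiOn_of_deriv_neg (convex_Ioc 0 1)
    · exact fun t ht => (hd t ht.1 ht.2).continuousAt.continuousWithinAt
    intro t ht
    rw [interior_Ioc] at ht
    rw [(hd t ht.1 ht.2.le).deriv]
    have h := at_lt ha ha1 ht.2.le
    have hD := D_pos ha ha1 ht.1 ht.2.le
    have h0 := ht.1
    have h1 : 0 < 1 - t := by linarith [ht.2]
    have : 1 / (1 + t) + (-a) / (1 - a * t) - (1 - 3 * a) / (1 + t + a - 3 * a * t)
        - a * (1 - t) / (t * (1 - a * t)) =
        - (a * (1 - t) * ((1 + a) * (1 - t)) / (t * (1 - a * t) * (1 + t) * (1 + t + a - 3 * a * t))) := by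
      have e1 : (1 + t) ≠ 0 := by positivity
      have e2 := h.ne'
      have e3 := hD.ne'
      have e4 := h0.ne'
      rw [div_add_div _ _ e1 e2, div_sub_div _ _ (by positivity) e3, div_sub_div _ _ (by positivity) (by positivity),
        ← neg_div, div_eq_div_iff (by positivity) (by positivity)]
      ring
    rw [this]
    have : 0 < (a * (1 - t) * ((1 + a) * (1 - t)) / (t * (1 - a * t) * (1 + t) * (1 + t + a - 3 * a * t))) := by
      positivity
    linarith
  have h1 : L 1 < L t := hanti ⟨ht.1, ht.2.le⟩ ⟨one_pos, le_rfl⟩ ht.2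
  have ha' : 0 < 1 - a := by linarith
  have hL1 : L 1 = 0 := by
    simp only [L, lF_one]
    have : 1 + 1 + a - 3 * a * 1 = (1 + 1) * (1 - a * 1) := by ring
    rw [this, Real.log_mul (by norm_num) (by simpa using ha'.ne')]
    ring
  rw [hL1] at h1
  have h := at_lt ha ha1 ht.2.le
  have hD := D_pos ha ha1 ht.1 ht.2.le
  have h0 := ht.1
  rw [← Real.log_lt_log_iff (by positivity) (by positivity), Real.log_mul (by positivity) hD.ne',
    Real.log_mul (by positivity) h.ne', Real.log_exp]
  simp only [L] at h1
  linarith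

lemma expM_lt {a t : ℝ} (ha : 0 < a) (ha1 : a < 1) (ht : t ∈ Ioo (0:ℝ) 1) : 0 < 1 - Real.exp (lF a t) := by
  have := Real.exp_lt_one_iff.2 (lF_neg ha ha1 ht)
  linarith

lemma sq_deriv (t : ℝ) : HasDerivAt (fun t : ℝ => (1 - t) ^ 2) (2 * (1 - t) * (-1)) t := by
  have h := (hasDerivAt_id t).const_sub 1
  have h2 := h.fun_pow 2
  simpa using h2

lemma HF_deriv {a t : ℝ} (ha : 0 < a) (ha1 : a < 1) (ht : t ∈ Ioo (0:ℝ) 1) :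
    ∃ d < 0, HasDerivAt (HF a) d t := by
  have h0 := ht.1
  have hM := expM_lt ha ha1 ht
  have h := at_lt ha ha1 ht.2.le
  have h1 : HasDerivAt (fun t : ℝ => (1 - t) ^ 2) (2 * (1 - t) * (-1)) t := sq_deriv t
  have h2 := (hasDerivAt_id t).mul ((lF_deriv ha ha1 ht.1 ht.2.le).exp.const_sub 1)
  refine ⟨_, ?_, h1.div h2 (by simp; exact ⟨h0.ne', hM.ne'⟩)⟩
  apply div_neg_of_neg_of_pos
  · have hk := key ha ha1 ht
    simp only [id, Pi.mul_apply]
    set M := Real.exp (lF a t)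
    have h1t : 0 < 1 - t := by linarith [ht.2]
    have : 2 * (1 - t) * -1 * (t * (1 - M)) -
        (1 - t) ^ 2 * (1 * (1 - M) + t * -(M * (a * (1 - t) / (t * (1 - a * t))))) =
        - ((1 - t) / (1 - a * t) * ((1 + t) * (1 - a * t) - M * (1 + t + a - 3 * a * t))) := by
      have e := h.ne'
      have e6 : t * -(M * (a * (1 - t) / (t * (1 - a * t)))) = -(M * a * (1 - t)) / (1 - a * t) := by
        field_simp
      rw [e6]
      generalize hw : 1 - a * t = w at *
      have hw' : a * t = 1 - w := by linarith
      field_simp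
      linear_combination (M * (1 + t)) * hw'
    rw [this]
    have : 0 < (1 - t) / (1 - a * t) * ((1 + t) * (1 - a * t) - M * (1 + t + a - 3 * a * t)) := by
      apply mul_pos (by positivity); linarith
    linarith
  · have : 0 < t * (1 - Real.exp (lF a t)) := by positivity
    exact pow_pos this 2

lemma HF_cont {a : ℝ} (ha : 0 < a) (ha1 : a < 1) : ContinuousOn (HF a) (Ioo 0 1) := by
  intro t ht
  obtain ⟨d, _, h⟩ := HF_deriv ha ha1 ht
  exact h.continuousAt.continuousWithinAt

lemma HF_anti {a : ℝ} (ha : 0 < a) (ha1 : a < 1) : StrictAntiOn (HF a) (Ioo 0 1) := by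
  apply strictAntiOn_of_deriv_neg (convex_Ioo 0 1) (HF_cont ha ha1)
  intro t ht
  rw [interior_Ioo] at ht
  obtain ⟨d, hd, h⟩ := HF_deriv ha ha1 ht
  rwa [h.deriv]

lemma HF_lim {a : ℝ} (ha : 0 < a) (ha1 : a < 1) :
    Tendsto (HF a) (𝓝[<] 1) (𝓝 (2 * (1 - a) / a)) := by
  have hc : ContinuousAt (lF a) 1 := (lF_deriv ha ha1 one_pos le_rfl).continuousAt
  have hev : ∀ᶠ t in 𝓝[<] (1:ℝ), t ∈ Ioo (0:ℝ) 1 := Ioo_mem_nhdsLT one_pos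
  have key2 : Tendsto (fun t => (1 - t) ^ 2 / (1 - Real.exp (lF a t))) (𝓝[<] 1) (𝓝 (2 * (1 - a) / a)) := by
    apply HasDerivAt.lhopital_zero_nhdsLT (f' := fun t => 2 * (1 - t) * (-1))
      (g' := fun t => -(Real.exp (lF a t) * (a * (1 - t) / (t * (1 - a * t)))))
    · filter_upwards with t
      exact sq_deriv t
    · filter_upwards [hev] with t ht
      exact ((lF_deriv ha ha1 ht.1 ht.2.le).exp.const_sub 1)
    · filter_upwards [hev] with t ht
      have h := at_lt ha ha1 ht.2.le
      have h1t : 0 < 1 - t := by linarith [ht.2]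
      have := ht.1
      have : 0 < Real.exp (lF a t) * (a * (1 - t) / (t * (1 - a * t))) := by positivity
      linarith
    · apply Tendsto.mono_left _ nhdsWithin_le_nhds
      have : ContinuousAt (fun t : ℝ => (1 - t) ^ 2) 1 := by fun_prop
      simpa [ContinuousAt] using this
    · apply Tendsto.mono_left _ nhdsWithin_le_nhds
      have : ContinuousAt (fun t : ℝ => 1 - Real.exp (lF a t)) 1 := by fun_prop
      simpa [ContinuousAt, lF_one] using this
    · have h3 : Tendsto (fun t => 2 * (t * (1 - a * t)) / (a * Real.exp (lF a t))) (𝓝[<] 1) (𝓝 (2 * (1 - a) / a)) := by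
        apply Tendsto.mono_left _ nhdsWithin_le_nhds
        have : ContinuousAt (fun t : ℝ => 2 * (t * (1 - a * t)) / (a * Real.exp (lF a t))) 1 := by
          apply ContinuousAt.div (by fun_prop) (by fun_prop) (by positivity)
        simpa [ContinuousAt, lF_one] using this
      refine h3.congr' ?_
      filter_upwards [hev] with t ht
      have h := at_lt ha ha1 ht.2.le
      have h1t : 0 < 1 - t := by linarith [ht.2]
      have := ht.1
      have hE := Real.exp_pos (lF a t)
      set E := Real.exp (lF a t)
      field_simp
  have h4 : Tendsto (fun t : ℝ => t⁻¹) (𝓝[<] 1) (𝓝 1) := by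
    apply Tendsto.mono_left _ nhdsWithin_le_nhds
    simpa using (tendsto_inv₀ (one_ne_zero (α := ℝ)))
  have := h4.mul key2
  rw [one_mul] at this
  refine this.congr fun t => ?_
  simp only [HF, div_eq_mul_inv, mul_inv]
  ring

lemma HF_gt {a t : ℝ} (ha : 0 < a) (ha1 : a < 1) (ht : t ∈ Ioo (0:ℝ) 1) : 2 * (1 - a) / a < HF a t := by
  obtain ⟨s, hs⟩ := exists_between ht.2
  have hs' : s ∈ Ioo (0:ℝ) 1 := ⟨ht.1.trans hs.1, hs.2⟩
  refine lt_of_le_of_lt ?_ (HF_anti ha ha1 ht hs' hs.1)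
  apply le_of_tendsto (HF_lim ha ha1)
  filter_upwards [Ioo_mem_nhdsLT hs.2] with x hx
  exact (HF_anti ha ha1 hs' ⟨hs'.1.trans hx.1, hx.2⟩ hx.1).le

lemma HF_surj {a y : ℝ} (ha : 0 < a) (ha1 : a < 1) (hy : 2 * (1 - a) / a < y) :
    ∃ t ∈ Ioo (0:ℝ) 1, HF a t = y := by
  have hy0 : 0 < y := lt_trans (by have : 0 < 1 - a := by linarith
                                   positivity) hy
  -- a point near 0
  obtain ⟨s, hs, hys⟩ : ∃ s ∈ Ioo (0:ℝ) 1, y < HF a s := by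
    refine ⟨1 / (y + 2 + 1), ⟨by positivity, ?_⟩, ?_⟩
    · rw [div_lt_one (by positivity)]; linarith
    set s := 1 / (y + 2 + 1) with hsd
    have hs0 : 0 < s := by positivity
    have hs1 : s < 1 := by rw [hsd, div_lt_one (by positivity)]; linarith
    have hM := expM_lt ha ha1 ⟨hs0, hs1⟩
    have hE := Real.exp_pos (lF a s)
    unfold HF
    rw [lt_div_iff₀ (by positivity)]
    have e : s * (y + 2 + 1) = 1 := by rw [hsd]; field_simp
    have : y * (s * (1 - Real.exp (lF a s))) < y * s := by
      have : 0 < y * s := by positivity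
      nlinarith
    nlinarith
  obtain ⟨u, hu, hyu⟩ := (((HF_lim ha ha1).eventually (gt_mem_nhds hy)).and (Ioo_mem_nhdsLT hs.2)).exists
  have hsub : Icc s u ⊆ Ioo 0 1 := fun x hx => ⟨hs.1.trans_le hx.1, hx.2.trans_lt hyu.2⟩
  obtain ⟨t, ht, e⟩ := intermediate_value_Ioo' hyu.1.le ((HF_cont ha ha1).mono hsub)
    (show y ∈ Ioo (HF a u) (HF a s) from ⟨hu, hys⟩)
  exact ⟨t, hsub ⟨ht.1.le, ht.2.le⟩, e⟩

lemma mMax_pos {n : ℕ} (hn : 3 ≤ n) : 0 < mMax n := by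
  have h3 : (3:ℝ) ≤ n := by exact_mod_cast hn
  have : 0 < (n:ℝ) - 2 := by linarith
  unfold mMax
  positivity

lemma log_mMax {n : ℕ} (hn : 3 ≤ n) :
    Real.log (mMax n) = (((n:ℝ) - 2) * Real.log ((n:ℝ) - 2) - n * Real.log n) / 2 := by
  have h3 : (3:ℝ) ≤ n := by exact_mod_cast hn
  have h : 0 < (n:ℝ) - 2 := by linarith
  unfold mMax
  rw [Real.log_sqrt (by positivity), Real.log_div (by positivity) (by positivity), Real.log_pow, Real.log_pow,
    Nat.cast_sub (by omega)]
  norm_num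

lemma fSD_iff {n : ℕ} (hn : 3 ≤ n) {m r : ℝ} (hm : 0 < m) (hr : 0 < r) :
    fSD n m r = 0 ↔ r < 1 ∧
      Real.log m - Real.log (mMax n) = n / 2 * lF (((n:ℝ) - 2) / n) (r ^ 2 / (((n:ℝ) - 2) / n)) := by
  have h3 : (3:ℝ) ≤ n := by exact_mod_cast hn
  have h : 0 < (n:ℝ) - 2 := by linarith
  have hn0 : 0 < (n:ℝ) := by linarith
  have hp : 0 < r ^ (2 - (n:ℝ)) := by positivity
  have step : r < 1 → (fSD n m r = 0 ↔
      Real.log m - Real.log (mMax n) = n / 2 * lF (((n:ℝ) - 2) / n) (r ^ 2 / (((n:ℝ) - 2) / n))) := by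
    intro hr1
    have hq : 0 < 1 - r ^ 2 := by nlinarith
    have e0 : fSD n m r = 0 ↔ 1 - r ^ 2 = 2 * m * r ^ (2 - (n : ℝ)) := by
      unfold fSD; exact sub_eq_zero
    rw [e0, ← Real.log_injOn_pos.eq_iff (show 1 - r ^ 2 ∈ Ioi (0:ℝ) from hq)
      (show 2 * m * r ^ (2 - (n : ℝ)) ∈ Ioi (0:ℝ) from by simp only [mem_Ioi]; positivity),
      Real.log_mul (by positivity) hp.ne', Real.log_mul (by norm_num) hm.ne', Real.log_rpow hr,
      log_mMax hn]
    have e1 : (((n:ℝ) - 2) / n) * (r ^ 2 / (((n:ℝ) - 2) / n)) = r ^ 2 := by field_simp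
    have e2 : 1 - ((n:ℝ) - 2) / n = 2 / n := by field_simp; ring
    unfold lF
    rw [e1, e2, Real.log_div (by positivity) (by positivity), Real.log_div h.ne' hn0.ne', Real.log_pow,
      Real.log_div (by norm_num) hn0.ne']
    have e3 : (n:ℝ) / 2 * (((n:ℝ) - 2) / n * ((2:ℕ) * Real.log r - (Real.log ((n:ℝ) - 2) - Real.log n)) +
      2 / n * (Real.log (1 - r ^ 2) - (Real.log 2 - Real.log n))) =
      ((n:ℝ) - 2) / 2 * (2 * Real.log r - (Real.log ((n:ℝ) - 2) - Real.log n)) +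
       (Real.log (1 - r ^ 2) - (Real.log 2 - Real.log n)) := by
      push_cast
      field_simp
    rw [e3]
    constructor <;> intro H <;> linarith
  constructor
  · intro hf
    have hr1 : r < 1 := by
      unfold fSD at hf
      have : 0 < 2 * m * r ^ (2 - (n:ℝ)) := by positivity
      nlinarith
    exact ⟨hr1, (step hr1).1 hf⟩
  · exact fun ⟨h1, h2⟩ => (step h1).2 h2

lemma km_eq {n : ℕ} (hn : 3 ≤ n) {km : ℝ → ℝ}
    (hk : ∀ m ∈ Set.Ioo (0 : ℝ) (mMax n), ∀ rm : ℝ,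
      IsLeast {r : ℝ | 0 < r ∧ fSD n m r = 0} rm →
      km m = Real.sqrt (rm ^ 2 * (1 - ((n : ℝ) - 2) * m * rm ^ (-(n : ℝ))) ^ 2 /
        (1 - (m / mMax n) ^ ((2 : ℝ) / n)))) {t m : ℝ} (ht : t ∈ Ioo (0:ℝ) 1) (hm : m ∈ Ioo 0 (mMax n))
    (hmt : Real.log m - Real.log (mMax n) = n / 2 * lF (((n:ℝ) - 2) / n) t) :
    km m = Real.sqrt (n * (n - 2) / 4 * HF (((n:ℝ) - 2) / n) t) := by
  have h3 : (3:ℝ) ≤ n := by exact_mod_cast hn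
  have h : 0 < (n:ℝ) - 2 := by linarith
  have hn0 : 0 < (n:ℝ) := by linarith
  set a := ((n:ℝ) - 2) / n with had
  have ha : 0 < a := by positivity
  have ha1 : a < 1 := by rw [had, div_lt_one hn0]; linarith
  have ht0 := ht.1
  set r := Real.sqrt (a * t) with hrd
  have hr : 0 < r := Real.sqrt_pos.2 (by positivity)
  have hr2 : r ^ 2 = a * t := Real.sq_sqrt (by positivity)
  have hat := at_lt ha ha1 ht.2.le
  have hr1 : r < 1 := by nlinarith
  have hf : fSD n m r = 0 := by
    rw [fSD_iff hn hm.1 hr]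
    refine ⟨hr1, ?_⟩
    rw [← had, hr2, mul_div_cancel_left₀ _ ha.ne', hmt]
  have hL : IsLeast {r : ℝ | 0 < r ∧ fSD n m r = 0} r := by
    refine ⟨⟨hr, hf⟩, ?_⟩
    rintro q ⟨hq, hqf⟩
    rw [fSD_iff hn hm.1 hq, ← had, hmt] at hqf
    by_contra! hlt
    have h1 : q ^ 2 / a < t := by
      rw [div_lt_iff₀ ha]
      nlinarith
    have h2 := lF_mono ha ha1 ⟨by positivity, (h1.trans ht.2).le⟩ ⟨ht.1, ht.2.le⟩ h1
    have h3 := hqf.2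
    have : lF a t = lF a (q ^ 2 / a) := mul_left_cancel₀ (by positivity) h3
    linarith
  rw [hk m hm r hL]
  congr 1
  have hM : (m / mMax n) ^ ((2:ℝ) / n) = Real.exp (lF a t) := by
    rw [Real.rpow_def_of_pos (div_pos hm.1 (mMax_pos hn)), Real.log_div hm.1.ne' (mMax_pos hn).ne', hmt]
    congr 1
    field_simp
  rw [hM]
  have hE := expM_lt ha ha1 ht
  have hr4 : m * r ^ (-(n:ℝ)) = (1 - r ^ 2) / (2 * r ^ 2) := by
    have e : r ^ (2 - (n:ℝ)) = r ^ 2 * r ^ (-(n:ℝ)) := by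
      rw [sub_eq_add_neg, Real.rpow_add hr]; norm_num
    unfold fSD at hf
    rw [e] at hf
    rw [eq_div_iff (by positivity)]
    linarith
  rw [mul_assoc ((n:ℝ) - 2), hr4, hr2]
  unfold HF
  set E := Real.exp (lF a t)
  have hna : (n:ℝ) - 2 = a * n := by rw [had]; field_simp
  have hna2 : (a * n - n : ℝ) = -2 := by linarith
  rw [hna]
  have e5 : 1 - a * n * ((1 - a * t) / (2 * (a * t))) = n * (t - 1) / (2 * t) := by
    have : a * (n:ℝ) = n - 2 := by linarith
    have e6 : a * n * ((1 - a * t) / (2 * (a * t))) = n * (1 - a * t) / (2 * t) := by field_simp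
    rw [e6, eq_div_iff (by positivity), sub_mul, div_mul_cancel₀ _ (by positivity)]
    linear_combination t * this
  rw [e5]
  field_simp
  ring

/-- k_- is a continuous strictly decreasing bijection from (0, m_max]
onto [sqrt n, ∞), with k_-(m) → +∞ as m → 0⁺ and k_-(m) → sqrt n as m → m_max⁻. -/
theorem stmt11 (n : ℕ) (hn : 3 ≤ n) (km : ℝ → ℝ)
    (hkmax : km (mMax n) = Real.sqrt n)
    (hk : ∀ m ∈ Set.Ioo (0 : ℝ) (mMax n), ∀ rm : ℝ,
      IsLeast {r : ℝ | 0 < r ∧ fSD n m r = 0} rm →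
      km m = Real.sqrt (rm ^ 2 * (1 - ((n : ℝ) - 2) * m * rm ^ (-(n : ℝ))) ^ 2 /
        (1 - (m / mMax n) ^ ((2 : ℝ) / n)))) :
    ContinuousOn km (Set.Ioc 0 (mMax n)) ∧
    StrictAntiOn km (Set.Ioc 0 (mMax n)) ∧
    Set.BijOn km (Set.Ioc 0 (mMax n)) (Set.Ici (Real.sqrt n)) ∧
    Filter.Tendsto km (𝓝[>] 0) Filter.atTop ∧
    Filter.Tendsto km (𝓝[<] (mMax n)) (𝓝 (Real.sqrt n)) := by
  have h3 : (3:ℝ) ≤ n := by exact_mod_cast hn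
  have h : 0 < (n:ℝ) - 2 := by linarith
  have hn0 : 0 < (n:ℝ) := by linarith
  have hmp := mMax_pos hn
  obtain ⟨a, had⟩ : ∃ a, a = ((n:ℝ) - 2) / n := ⟨_, rfl⟩
  have ha : 0 < a := by rw [had]; positivity
  have ha1 : a < 1 := by rw [had, div_lt_one hn0]; linarith
  have hlim : (n:ℝ) * (n - 2) / 4 * (2 * (1 - a) / a) = n := by
    rw [had]; field_simp; ring
  have hc : 0 < (n:ℝ) * (n - 2) / 4 := by positivity
  have hkt : ∀ m ∈ Ioo 0 (mMax n), ∃ t ∈ Ioo (0:ℝ) 1,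
      Real.log m - Real.log (mMax n) = n / 2 * lF a t ∧ km m = Real.sqrt (n * (n - 2) / 4 * HF a t) := by
    intro m hm
    have hl : 2 / n * (Real.log m - Real.log (mMax n)) < 0 := by
      have := Real.log_lt_log hm.1 hm.2
      apply mul_neg_of_pos_of_neg (by positivity); linarith
    obtain ⟨t, ht, e⟩ := lF_surj ha ha1 hl
    have e' : Real.log m - Real.log (mMax n) = n / 2 * lF a t := by rw [e]; field_simp
    exact ⟨t, ht, e', by rw [had] at e' ⊢; exact km_eq hn hk ht hm e'⟩
  have hgt : ∀ m ∈ Ioo 0 (mMax n), Real.sqrt n < km m := by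
    intro m hm
    obtain ⟨t, ht, -, e⟩ := hkt m hm
    rw [e]
    apply Real.sqrt_lt_sqrt hn0.le
    have := mul_lt_mul_of_pos_left (HF_gt ha ha1 ht) hc
    rwa [hlim] at this
  have hanti : StrictAntiOn km (Set.Ioc 0 (mMax n)) := by
    intro x hx y hy hxy
    have hx' : x ∈ Ioo 0 (mMax n) := ⟨hx.1, hxy.trans_le hy.2⟩
    rcases hy.2.eq_or_lt with hy1 | hy1
    · rw [hy1, hkmax]; exact hgt x hx'
    obtain ⟨t, ht, e1, e⟩ := hkt x hx'
    obtain ⟨u, hu, f1, f⟩ := hkt y ⟨hy.1, hy1⟩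
    rw [e, f]
    have hlog := Real.log_lt_log hx.1 hxy
    have hl : lF a t < lF a u := by
      have : n / 2 * lF a t < n / 2 * lF a u := by linarith
      exact lt_of_mul_lt_mul_left this (by positivity)
    have htu : t < u := (lF_mono ha ha1).lt_iff_lt ⟨ht.1, ht.2.le⟩ ⟨hu.1, hu.2.le⟩ |>.1 hl
    have hu0 : 0 < HF a u := lt_trans (by have : 0 < 1 - a := by linarith
                                          positivity) (HF_gt ha ha1 hu)
    apply Real.sqrt_lt_sqrt (by positivity)
    exact mul_lt_mul_of_pos_left (HF_anti ha ha1 ht hu htu) hc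
  have hsurj : SurjOn km (Set.Ioc 0 (mMax n)) (Set.Ici (Real.sqrt n)) := by
    intro y hy
    rcases (mem_Ici.1 hy).eq_or_lt with h1 | h1
    · exact ⟨mMax n, ⟨hmp, le_rfl⟩, by rw [hkmax, h1]⟩
    have hy0 : 0 < y := (Real.sqrt_nonneg _).trans_lt h1
    have hy2 : (n:ℝ) < y ^ 2 := (Real.sqrt_lt' hy0).1 h1
    have : 2 * (1 - a) / a < y ^ 2 / ((n:ℝ) * (n - 2) / 4) := by
      rw [lt_div_iff₀ hc]; linarith
    obtain ⟨t, ht, e⟩ := HF_surj ha ha1 this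
    have hl := lF_neg ha ha1 ht
    have hm : mMax n * Real.exp (n / 2 * lF a t) ∈ Ioo 0 (mMax n) := by
      refine ⟨by positivity, ?_⟩
      apply mul_lt_of_lt_one_right hmp
      apply Real.exp_lt_one_iff.2
      apply mul_neg_of_pos_of_neg (by positivity) hl
    refine ⟨_, ⟨hm.1, hm.2.le⟩, ?_⟩
    rw [km_eq hn hk ht hm, ← had, e, mul_div_cancel₀ _ hc.ne', Real.sqrt_sq hy0.le]
    rw [Real.log_mul hmp.ne' (by positivity), Real.log_exp, had]
    ring
  have hmaps : MapsTo km (Set.Ioc 0 (mMax n)) (Set.Ici (Real.sqrt n)) := by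
    intro x hx
    rcases hx.2.eq_or_lt with h1 | h1
    · rw [h1, hkmax]; exact self_mem_Ici
    · exact (hgt x ⟨hx.1, h1⟩).le
  have himg : (fun x => - km x) '' (Set.Ioc 0 (mMax n)) = Iic (-Real.sqrt n) := by
    ext y
    constructor
    · rintro ⟨x, hx, rfl⟩
      exact mem_Iic.2 (neg_le_neg (mem_Ici.1 (hmaps hx)))
    · intro hy
      obtain ⟨x, hx, e⟩ := hsurj (show -y ∈ Ici (Real.sqrt n) from by
        simp only [mem_Ici, mem_Iic] at *; linarith)
      exact ⟨x, hx, by simp [e]⟩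
  have hcont : ContinuousOn km (Set.Ioc 0 (mMax n)) := by
    have hmono : StrictMonoOn (fun x => - km x) (Set.Ioc 0 (mMax n)) := hanti.neg
    have : OrdConnected ((fun x => - km x) '' (Set.Ioc 0 (mMax n))) := by
      rw [himg]; exact ordConnected_Iic
    have hcc := (hmono.orderIso _ _).continuous
    have h2 : ContinuousOn (fun x => - km x) (Set.Ioc 0 (mMax n)) := by
      rw [continuousOn_iff_continuous_domRestrict]
      exact continuous_subtype_val.comp hcc
    exact h2.neg.congr fun x _ => by simp
  refine ⟨hcont, hanti, ⟨hmaps, hanti.injOn, hsurj⟩, ?_, ?_⟩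
  · rw [tendsto_atTop]
    intro b
    obtain ⟨x, hx, e⟩ := hsurj (show max b (Real.sqrt n) ∈ Ici (Real.sqrt n) from mem_Ici.2 (le_max_right _ _))
    filter_upwards [Ioo_mem_nhdsGT hx.1] with y hy
    have := hanti ⟨hy.1, hy.2.le.trans hx.2⟩ hx hy.2
    rw [e] at this
    exact (le_max_left _ _).trans this.le
  · have h1 := hcont (mMax n) ⟨hmp, le_rfl⟩
    rw [ContinuousWithinAt, hkmax] at h1
    refine h1.mono_left ?_
    rw [← nhdsWithin_Ioo_eq_nhdsLT hmp]
    exact nhdsWithin_mono _ Ioo_subset_Ioc_self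
end
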